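/- arXiv:2108.04892 — 6 statements merged into one kernel-verified Lean document; each statement's English description precedes it below -/
import Mathlib

section
/- For every b ≥ 1, the functional corruptibility satisfies the decomposition FC_{b+1} = FC_b + N_{new} / 2^{(b+1+t_k)·n}, where N_{new} is the number of new errors at depth b+1, i.e. the number of pairs (i, k) with i : Fin (b+1) → Inp and k : Fin t_k → Inp such that f_{b+1}(i) ≠ f'_{b+1}(i, k) and f_b(pre(i)) = f'_b(pre(i), k). -/
/-- A Mealy machine with input alphabet `Inp` and output alphabet `Out`. -/
structure Mealy (Inp Out : Type) where
  S : Type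
  δ : S → Inp → S
  ω : S → Inp → Out

namespace Mealy

variable {Inp Out : Type}

/-- The state reached from `s` after consuming an input sequence of length `b`. -/
def states (M : Mealy Inp Out) (s : M.S) : (b : ℕ) → (Fin b → Inp) → M.S
  | 0, _ => s
  | b + 1, i => M.δ (M.states s b (i ∘ Fin.castSucc)) (i (Fin.last b))

/-- The `b`-unrolled output from state `s`: `out s b i t = ω s_t (i t)`,
where `s_0 = s` and `s_{t+1} = δ s_t (i t)`. -/
def out (M : Mealy Inp Out) (s : M.S) (b : ℕ) (i : Fin b → Inp) (t : Fin b) : Out :=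
  M.ω (M.states s t.1 (fun j => i (Fin.castLE t.isLt.le j))) (i t)

end Mealy

/-- Input alphabet: `n`-bit vectors. -/
abbrev Inp (n : ℕ) : Type := Fin n → Bool

/-- Output alphabet: `m`-bit vectors. -/
abbrev Out (m : ℕ) : Type := Fin m → Bool

/-- The prefix of a `(b+1)`-length sequence. -/
def pre {α : Type} {b : ℕ} (i : Fin (b + 1) → α) : Fin b → α := i ∘ Fin.castSucc

/-- `f_b`: the `b`-unrolled output of the oracle circuit from its initial state `s0`. -/
def fOut {n m : ℕ} (Mo : Mealy (Inp n) (Out m)) (s0 : Mo.S) (b : ℕ)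
    (i : Fin b → Inp n) : Fin b → Out m :=
  Mo.out s0 b i

/-- `f'_b`: the `b`-unrolled output of the encrypted circuit after applying the
key sequence `k` from its initial state `s0'`. -/
def fOut' {n m : ℕ} (tk : ℕ) (Me : Mealy (Inp n) (Out m)) (s0' : Me.S) (b : ℕ)
    (i : Fin b → Inp n) (k : Fin tk → Inp n) : Fin b → Out m :=
  Me.out (Me.states s0' tk k) b i

/-- The number of error pairs `(i, k)` at unrolling depth `b`. -/
def errCount {n m : ℕ} (tk : ℕ) (Mo Me : Mealy (Inp n) (Out m)) (s0 : Mo.S) (s0' : Me.S)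
    (b : ℕ) : ℕ :=
  Fintype.card {p : (Fin b → Inp n) × (Fin tk → Inp n) //
    fOut Mo s0 b p.1 ≠ fOut' tk Me s0' b p.1 p.2}

/-- The `b`-depth functional corruptibility. -/
def FC (n m tk : ℕ) (Mo Me : Mealy (Inp n) (Out m)) (s0 : Mo.S) (s0' : Me.S) (b : ℕ) : ℚ :=
  (errCount tk Mo Me s0 s0' b : ℚ) / 2 ^ ((b + tk) * n)

/-- `K̄_b`: the set of keys distinguishable at depth `b`. -/
def Kbar {n m : ℕ} (tk : ℕ) (Mo Me : Mealy (Inp n) (Out m)) (s0 : Mo.S) (s0' : Me.S)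
    (b : ℕ) : Set (Fin tk → Inp n) :=
  {k | ∃ i : Fin b → Inp n, fOut Mo s0 b i ≠ fOut' tk Me s0' b i k}

theorem Mealy.out_pre {α β : Type} (M : Mealy α β) (s : M.S) (b : ℕ) (i : Fin (b + 1) → α) :
    M.out s b (pre i) = pre (M.out s (b + 1) i) :=
  rfl

/-- Appending one free input symbol multiplies the number of pairs satisfying a property of
the prefix by the size of the alphabet. -/
theorem card_pre_subtype {α κ : Type} [Fintype α] [Fintype κ] {b : ℕ}
    (P : (Fin b → α) × κ → Prop) [DecidablePred P] :
    Fintype.card {p : (Fin (b + 1) → α) × κ // P (pre p.1, p.2)} =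
      Fintype.card α * Fintype.card {p : (Fin b → α) × κ // P p} := by
  rw [← Fintype.card_prod]
  refine Fintype.card_congr
    { toFun := fun p => (p.1.1 (Fin.last b), ⟨(pre p.1.1, p.1.2), p.2⟩)
      invFun := fun q => ⟨(Fin.snoc (α := fun _ => α) q.2.1.1 q.1, q.2.1.2), ?_⟩
      left_inv := ?_
      right_inv := ?_ }
  · have h : pre (Fin.snoc (α := fun _ => α) q.2.1.1 q.1) = q.2.1.1 := by
      funext t
      simp [pre]
    rw [h]
    exact q.2.2
  · rintro ⟨⟨i, k⟩, h⟩
    simp only [Subtype.mk.injEq, Prod.mk.injEq, and_true]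
    exact Fin.snoc_init_self i
  · rintro ⟨x, ⟨⟨i, k⟩, h⟩⟩
    simp only [Prod.mk.injEq, Fin.snoc_last, Subtype.mk.injEq, and_true, true_and]
    funext t
    simp [pre]

/-- An error on the prefix persists, so the errors at depth `b + 1` are the extensions of the
errors at depth `b` together with the new errors. -/
theorem errCount_succ {n m : ℕ} (tk : ℕ) (Mo Me : Mealy (Inp n) (Out m)) (s0 : Mo.S)
    (s0' : Me.S) (b : ℕ) :
    errCount tk Mo Me s0 s0' (b + 1) =
      2 ^ n * errCount tk Mo Me s0 s0' b +
        Fintype.card {p : (Fin (b + 1) → Inp n) × (Fin tk → Inp n) //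
          fOut Mo s0 (b + 1) p.1 ≠ fOut' tk Me s0' (b + 1) p.1 p.2 ∧
          fOut Mo s0 b (pre p.1) = fOut' tk Me s0' b (pre p.1) p.2} := by
  have hcard := card_pre_subtype (b := b)
    (fun p : (Fin b → Inp n) × (Fin tk → Inp n) =>
      fOut Mo s0 b p.1 ≠ fOut' tk Me s0' b p.1 p.2)
  have hInp : Fintype.card (Inp n) = 2 ^ n := by simp
  have hpre (p : (Fin (b + 1) → Inp n) × (Fin tk → Inp n))
      (h : fOut Mo s0 (b + 1) p.1 = fOut' tk Me s0' (b + 1) p.1 p.2) :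
      fOut Mo s0 b (pre p.1) = fOut' tk Me s0' b (pre p.1) p.2 := by
    unfold fOut fOut' at h ⊢
    rw [Mealy.out_pre, Mealy.out_pre, h]
  rw [hInp] at hcard
  unfold errCount
  rw [← hcard, ← Fintype.card_subtype_or_disjoint]
  · refine Fintype.card_congr (Equiv.subtypeEquivRight fun p => ?_)
    have := hpre p
    tauto
  · rw [Pi.disjoint_iff]
    intro p
    rw [Prop.disjoint_iff]
    tauto

/-- `FC_{b+1} = FC_b + N_new / 2^{(b+1+t_k)·n}`, where `N_new` counts the
new errors at depth `b+1`. -/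
theorem stmt_3 (n m tk : ℕ) (hn : 1 ≤ n) (hm : 1 ≤ m) (htk : 1 ≤ tk)
    (Mo Me : Mealy (Inp n) (Out m)) (s0 : Mo.S) (s0' : Me.S)
    (b : ℕ) (hb : 1 ≤ b) :
    FC n m tk Mo Me s0 s0' (b + 1) =
      FC n m tk Mo Me s0 s0' b +
        (Fintype.card {p : (Fin (b + 1) → Inp n) × (Fin tk → Inp n) //
            fOut Mo s0 (b + 1) p.1 ≠ fOut' tk Me s0' (b + 1) p.1 p.2 ∧
            fOut Mo s0 b (pre p.1) = fOut' tk Me s0' b (pre p.1) p.2} : ℚ) /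
          2 ^ ((b + 1 + tk) * n) := by
  unfold FC
  rw [errCount_succ, show (b + 1 + tk) * n = n + (b + tk) * n by ring, pow_add]
  push_cast
  field_simp
end

section
/- (Theorem 1) For every b ≥ 1, FC_{b+1} = FC_b holds if and only if there are no new errors at depth b+1; that is, if and only if for every i : Fin (b+1) → Inp and every key k : Fin t_k → Inp with f_{b+1}(i) ≠ f'_{b+1}(i, k), the prefix already errs: f_b(pre(i)) ≠ f'_b(pre(i), k). -/
theorem pre_snoc {α : Type} {b : ℕ} (i : Fin b → α) (a : α) :
    pre (Fin.snoc i a : Fin (b + 1) → α) = i := by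
  funext t
  simp [pre]

theorem snoc_pre_last {α : Type} {b : ℕ} (i : Fin (b + 1) → α) :
    (Fin.snoc (pre i) (i (Fin.last b)) : Fin (b + 1) → α) = i :=
  Fin.snoc_init_self i

/-- Sequences whose prefix satisfies a predicate are the one-letter extensions of the sequences
satisfying it. -/
def prefixSubtypeEquiv {α β : Type} (b : ℕ) (P : (Fin b → α) → β → Prop) :
    {p : (Fin (b + 1) → α) × β // P (pre p.1) p.2} ≃
      α × {p : (Fin b → α) × β // P p.1 p.2} where
  toFun p := (p.1.1 (Fin.last b), ⟨(pre p.1.1, p.1.2), p.2⟩)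
  invFun x := ⟨(Fin.snoc x.2.1.1 x.1, x.2.1.2), by simpa only [pre_snoc] using x.2.2⟩
  left_inv p := Subtype.ext (Prod.ext (snoc_pre_last p.1.1) rfl)
  right_inv x := by
    obtain ⟨a, ⟨i, k⟩, h⟩ := x
    simp [pre_snoc]

theorem fOut_succ_ne_of_pre_ne {n m tk : ℕ} {Mo Me : Mealy (Inp n) (Out m)} {s0 : Mo.S}
    {s0' : Me.S} {b : ℕ} {i : Fin (b + 1) → Inp n} {k : Fin tk → Inp n}
    (h : fOut Mo s0 b (pre i) ≠ fOut' tk Me s0' b (pre i) k) :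
    fOut Mo s0 (b + 1) i ≠ fOut' tk Me s0' (b + 1) i k :=
  fun e => h (funext fun t => congrFun e t.castSucc)

theorem FC_succ_eq_iff_errCount {n m tk : ℕ} (Mo Me : Mealy (Inp n) (Out m)) (s0 : Mo.S)
    (s0' : Me.S) (b : ℕ) :
    FC n m tk Mo Me s0 s0' (b + 1) = FC n m tk Mo Me s0 s0' b ↔
      errCount tk Mo Me s0 s0' (b + 1) = 2 ^ n * errCount tk Mo Me s0 s0' b := by
  have e : (b + 1 + tk) * n = n + (b + tk) * n := by ring
  have h : (2 : ℚ) ^ ((b + tk) * n) ≠ 0 := by positivity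
  have h' : (2 : ℚ) ^ n ≠ 0 := by positivity
  rw [FC, FC, e, pow_add, ← div_div, div_left_inj' h, div_eq_iff h', mul_comm]
  exact_mod_cast Iff.rfl

/-- Theorem 1: `FC_{b+1} = FC_b` iff no new errors are introduced at
depth `b+1`. -/
theorem stmt_4 (n m tk : ℕ) (hn : 1 ≤ n) (hm : 1 ≤ m) (htk : 1 ≤ tk)
    (Mo Me : Mealy (Inp n) (Out m)) (s0 : Mo.S) (s0' : Me.S)
    (b : ℕ) (hb : 1 ≤ b) :
    FC n m tk Mo Me s0 s0' (b + 1) = FC n m tk Mo Me s0 s0' b ↔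
      ∀ (i : Fin (b + 1) → Inp n) (k : Fin tk → Inp n),
        fOut Mo s0 (b + 1) i ≠ fOut' tk Me s0' (b + 1) i k →
        fOut Mo s0 b (pre i) ≠ fOut' tk Me s0' b (pre i) k := by
  rw [FC_succ_eq_iff_errCount]
  set A : Set ((Fin (b + 1) → Inp n) × (Fin tk → Inp n)) :=
    {p | fOut Mo s0 (b + 1) p.1 ≠ fOut' tk Me s0' (b + 1) p.1 p.2}
  set B : Set ((Fin (b + 1) → Inp n) × (Fin tk → Inp n)) :=
    {p | fOut Mo s0 b (pre p.1) ≠ fOut' tk Me s0' b (pre p.1) p.2}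
  have hBA : B ⊆ A := fun p hp => fOut_succ_ne_of_pre_ne hp
  have cardA : errCount tk Mo Me s0 s0' (b + 1) = A.ncard := by
    rw [errCount, ← Nat.card_eq_fintype_card]
    rfl
  have cardB : 2 ^ n * errCount tk Mo Me s0 s0' b = B.ncard := by
    have h := Nat.card_congr
      (prefixSubtypeEquiv b fun i k => fOut Mo s0 b i ≠ fOut' tk Me s0' b i k)
    rw [Nat.card_prod] at h
    rw [errCount, ← Nat.card_eq_fintype_card]
    refine Eq.trans ?_ h.symm
    simp
  rw [cardA, cardB]
  constructor
  · intro h i k hik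
    have hAB : B = A := Set.eq_of_subset_of_ncard_le hBA h.le
    exact hAB.symm.subset (show (i, k) ∈ A from hik)
  · intro h
    rw [Set.Subset.antisymm (fun p hp => h p.1 p.2 hp) hBA]
end

section
/- For every b ≥ 1, FC_{b+1} > FC_b holds if and only if there exists a new error at depth b+1, i.e. there exist i : Fin (b+1) → Inp and k : Fin t_k → Inp such that f_{b+1}(i) ≠ f'_{b+1}(i, k) while f_b(pre(i)) = f'_b(pre(i), k). -/
/-- Errors persist when the unrolling depth grows. -/
theorem fOut_ne_of_pre_ne {n m tk b : ℕ} {Mo Me : Mealy (Inp n) (Out m)} {s0 : Mo.S} {s0' : Me.S}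
    {i : Fin (b + 1) → Inp n} {k : Fin tk → Inp n}
    (h : fOut Mo s0 b (pre i) ≠ fOut' tk Me s0' b (pre i) k) :
    fOut Mo s0 (b + 1) i ≠ fOut' tk Me s0' (b + 1) i k := by
  contrapose! h
  funext t
  exact congrFun h t.castSucc

/-- Each error at depth `b` has `2 ^ n` one-step extensions. -/
theorem card_pre_error {n m : ℕ} (tk : ℕ) (Mo Me : Mealy (Inp n) (Out m)) (s0 : Mo.S)
    (s0' : Me.S) (b : ℕ) :
    Fintype.card {q : (Fin (b + 1) → Inp n) × (Fin tk → Inp n) //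
      fOut Mo s0 b (pre q.1) ≠ fOut' tk Me s0' b (pre q.1) q.2} =
    errCount tk Mo Me s0 s0' b * 2 ^ n := by
  have e : {q : (Fin (b + 1) → Inp n) × (Fin tk → Inp n) //
      fOut Mo s0 b (pre q.1) ≠ fOut' tk Me s0' b (pre q.1) q.2} ≃
      {p : (Fin b → Inp n) × (Fin tk → Inp n) //
        fOut Mo s0 b p.1 ≠ fOut' tk Me s0' b p.1 p.2} × Inp n :=
    { toFun q := (⟨(pre q.1.1, q.1.2), q.2⟩, q.1.1 (Fin.last b))
      invFun r := ⟨(Fin.snoc (α := fun _ => Inp n) r.1.1.1 r.2, r.1.1.2), by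
        have h : pre (Fin.snoc (α := fun _ => Inp n) r.1.1.1 r.2) = r.1.1.1 :=
          Fin.init_snoc (α := fun _ => Inp n) _ _
        simpa only [h] using r.1.2⟩
      left_inv q := Subtype.ext (Prod.ext (Fin.snoc_init_self (α := fun _ => Inp n) q.1.1) rfl)
      right_inv r := Prod.ext
        (Subtype.ext (Prod.ext (Fin.init_snoc (α := fun _ => Inp n) _ _) rfl))
        (Fin.snoc_last (α := fun _ => Inp n) _ _) }
  rw [Fintype.card_congr e, Fintype.card_prod, errCount]
  simp

theorem FC_lt_FC_succ_iff {n m tk b : ℕ} (Mo Me : Mealy (Inp n) (Out m)) (s0 : Mo.S)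
    (s0' : Me.S) :
    FC n m tk Mo Me s0 s0' b < FC n m tk Mo Me s0 s0' (b + 1) ↔
      errCount tk Mo Me s0 s0' b * 2 ^ n < errCount tk Mo Me s0 s0' (b + 1) := by
  have h : (2 : ℚ) ^ ((b + 1 + tk) * n) = 2 ^ ((b + tk) * n) * 2 ^ n := by
    rw [← pow_add]; ring_nf
  rw [FC, FC, h, ← mul_div_mul_right _ _ (by positivity : (2 : ℚ) ^ n ≠ 0),
    div_lt_div_iff_of_pos_right (by positivity)]
  exact_mod_cast Iff.rfl

/-- `FC_{b+1} > FC_b` iff there exists a new error at depth `b+1`. -/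
theorem stmt_6 (n m tk : ℕ) (hn : 1 ≤ n) (hm : 1 ≤ m) (htk : 1 ≤ tk)
    (Mo Me : Mealy (Inp n) (Out m)) (s0 : Mo.S) (s0' : Me.S)
    (b : ℕ) (hb : 1 ≤ b) :
    FC n m tk Mo Me s0 s0' b < FC n m tk Mo Me s0 s0' (b + 1) ↔
      ∃ (i : Fin (b + 1) → Inp n) (k : Fin tk → Inp n),
        fOut Mo s0 (b + 1) i ≠ fOut' tk Me s0' (b + 1) i k ∧
        fOut Mo s0 b (pre i) = fOut' tk Me s0' b (pre i) k := by
  rw [FC_lt_FC_succ_iff, ← card_pre_error]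
  constructor
  · intro h
    by_contra! hne
    exact h.not_ge (Fintype.card_subtype_mono _ _ fun q hq => hne q.1 q.2 hq)
  · rintro ⟨i, k, hik, hpre⟩
    rw [errCount, Fintype.card_subtype, Fintype.card_subtype]
    refine Finset.card_lt_card (Finset.ssubset_iff_of_subset ?_ |>.mpr ⟨(i, k), ?_, ?_⟩)
    · exact Finset.monotone_filter_right _ fun q hq => fOut_ne_of_pre_ne
    · simpa using hik
    · simpa using hpre
end

section
/- Let b ≥ 1 and c ≥ 0. If the functional corruptibility is constant on the interval of depths [b, b+c], i.e. FC_{b'} = FC_b for every b' with b ≤ b' ≤ b+c, then the sets of keys distinguishable at depths b and b+c coincide: K̄_b = K̄_{b+c}. -/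
theorem Mealy.out_append_castAdd {Inp Out : Type} (M : Mealy Inp Out) (s : M.S) {b c : ℕ}
    (i : Fin b → Inp) (j : Fin c → Inp) (t : Fin b) :
    M.out s (b + c) (Fin.append i j) (Fin.castAdd c t) = M.out s b i t := by
  have hpre : (fun r : Fin t.1 => Fin.append i j (Fin.castLE (Fin.castAdd c t).isLt.le r)) =
      fun r => i (Fin.castLE t.isLt.le r) := by
    funext r
    exact Fin.append_left i j (Fin.castLE t.isLt.le r)
  unfold Mealy.out
  rw [Fin.append_left]
  exact congrArg (fun u => M.ω (M.states s t.1 u) (i t)) hpre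

/-- Extending an error input by any suffix gives an error input. -/
theorem fOut_append_ne {n m tk : ℕ} {Mo Me : Mealy (Inp n) (Out m)} {s0 : Mo.S} {s0' : Me.S}
    {b c : ℕ} {i : Fin b → Inp n} {k : Fin tk → Inp n} (j : Fin c → Inp n)
    (h : fOut Mo s0 b i ≠ fOut' tk Me s0' b i k) :
    fOut Mo s0 (b + c) (Fin.append i j) ≠ fOut' tk Me s0' (b + c) (Fin.append i j) k := by
  intro heq
  apply h
  funext t
  have ht := congrFun heq (Fin.castAdd c t)
  simpa only [fOut, fOut', Mealy.out_append_castAdd] using ht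

/-- If `FC` agrees at depths `b` and `b + c`, every error pair at depth `b + c` extends an
error pair at depth `b`. -/
theorem exists_append_of_FC_eq {n m tk : ℕ} {Mo Me : Mealy (Inp n) (Out m)} {s0 : Mo.S}
    {s0' : Me.S} {b c : ℕ}
    (h : FC n m tk Mo Me s0 s0' (b + c) = FC n m tk Mo Me s0 s0' b)
    {i : Fin (b + c) → Inp n} {k : Fin tk → Inp n}
    (hi : fOut Mo s0 (b + c) i ≠ fOut' tk Me s0' (b + c) i k) :
    ∃ (i₁ : Fin b → Inp n) (i₂ : Fin c → Inp n),
      Fin.append i₁ i₂ = i ∧ fOut Mo s0 b i₁ ≠ fOut' tk Me s0' b i₁ k := by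
  have hcount : errCount tk Mo Me s0 s0' (b + c) = errCount tk Mo Me s0 s0' b * 2 ^ (c * n) := by
    unfold FC at h
    have hpow : (2 : ℚ) ^ ((b + c + tk) * n) = 2 ^ ((b + tk) * n) * 2 ^ (c * n) := by
      rw [← pow_add]; congr 1; ring
    rw [hpow, div_eq_div_iff (by positivity) (by positivity)] at h
    have hne : (2 : ℚ) ^ ((b + tk) * n) ≠ 0 := by positivity
    have hq : (errCount tk Mo Me s0 s0' (b + c) : ℚ) =
        errCount tk Mo Me s0 s0' b * 2 ^ (c * n) :=
      mul_right_cancel₀ hne (by rw [h]; ring)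
    exact_mod_cast hq
  let extend : {p : (Fin b → Inp n) × (Fin tk → Inp n) //
        fOut Mo s0 b p.1 ≠ fOut' tk Me s0' b p.1 p.2} × (Fin c → Inp n) →
      {p : (Fin (b + c) → Inp n) × (Fin tk → Inp n) //
        fOut Mo s0 (b + c) p.1 ≠ fOut' tk Me s0' (b + c) p.1 p.2} :=
    fun q => ⟨(Fin.append q.1.1.1 q.2, q.1.1.2), fOut_append_ne q.2 q.1.2⟩
  have hinj : Function.Injective extend := by
    rintro ⟨⟨⟨i₁, k₁⟩, h₁⟩, j₁⟩ ⟨⟨⟨i₂, k₂⟩, h₂⟩, j₂⟩ heq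
    have hv := congrArg Subtype.val heq
    obtain ⟨happ, rfl⟩ := Prod.mk.inj hv
    obtain ⟨rfl, rfl⟩ := Prod.mk.inj ((Fin.appendEquiv b c).injective
      (a₁ := (i₁, j₁)) (a₂ := (i₂, j₂)) happ)
    rfl
  have hbij : Function.Bijective extend := by
    refine (Fintype.bijective_iff_injective_and_card extend).2 ⟨hinj, ?_⟩
    rw [Fintype.card_prod]
    have hcard : Fintype.card (Fin c → Inp n) = 2 ^ (c * n) := by
      simp [← pow_mul, mul_comm]
    rw [hcard]
    exact hcount.symm
  obtain ⟨⟨⟨⟨i₁, k₁⟩, h₁⟩, i₂⟩, heq⟩ := hbij.2 ⟨(i, k), hi⟩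
  obtain ⟨happ, rfl⟩ := Prod.mk.inj (congrArg Subtype.val heq)
  exact ⟨i₁, i₂, happ, h₁⟩

/-- if `FC` is constant on the interval of depths `[b, b+c]`, then
`K̄_b = K̄_{b+c}`. -/
theorem stmt_10 (n m tk : ℕ) (hn : 1 ≤ n) (hm : 1 ≤ m) (htk : 1 ≤ tk)
    (Mo Me : Mealy (Inp n) (Out m)) (s0 : Mo.S) (s0' : Me.S)
    (b : ℕ) (hb : 1 ≤ b) (c : ℕ)
    (h : ∀ b', b ≤ b' → b' ≤ b + c →
      FC n m tk Mo Me s0 s0' b' = FC n m tk Mo Me s0 s0' b) :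
    Kbar tk Mo Me s0 s0' b = Kbar tk Mo Me s0 s0' (b + c) := by
  ext k
  constructor
  · rintro ⟨i, hi⟩
    exact ⟨Fin.append i fun _ _ => false, fOut_append_ne _ hi⟩
  · rintro ⟨i, hi⟩
    obtain ⟨i₁, -, -, h₁⟩ := exists_append_of_FC_eq (h (b + c) (Nat.le_add_right b c) le_rfl) hi
    exact ⟨i₁, h₁⟩
end

section
/- For every b ≥ 1, the count form of the monotonicity of functional corruptibility holds: the number of error pairs at depth b+1 is at least 2^n times the number of error pairs at depth b, i.e. |{(i, k) : i : Fin (b+1) → Inp, k : Fin t_k → Inp, f_{b+1}(i) ≠ f'_{b+1}(i, k)}| ≥ 2^n · |{(j, k) : j : Fin b → Inp, k : Fin t_k → Inp, f_b(j) ≠ f'_b(j, k)}|. -/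
theorem Mealy.out_snoc_castSucc {I O : Type} (M : Mealy I O) (s : M.S) (b : ℕ) (i : Fin b → I)
    (x : I) (t : Fin b) :
    M.out s (b + 1) (Fin.snoc (α := fun _ => I) i x) t.castSucc = M.out s b i t := by
  have h (u : Fin b) : (Fin.snoc (α := fun _ => I) i x : Fin (b + 1) → I) u.castSucc = i u :=
    Fin.snoc_castSucc (α := fun _ => I) x i u
  have hpre : (fun j : Fin t.1 => (Fin.snoc (α := fun _ => I) i x : Fin (b + 1) → I)
      (Fin.castLE t.castSucc.isLt.le j)) = fun j => i (Fin.castLE t.isLt.le j) :=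
    funext fun j => h (Fin.castLE t.isLt.le j)
  unfold Mealy.out
  rw [h]
  exact congrArg (fun f => M.ω (M.states s t.1 f) (i t)) hpre

/-- the number of error pairs at depth `b+1` is at least `2^n` times
the number of error pairs at depth `b`. -/
theorem stmt_14 (n m tk : ℕ) (hn : 1 ≤ n) (hm : 1 ≤ m) (htk : 1 ≤ tk)
    (Mo Me : Mealy (Inp n) (Out m)) (s0 : Mo.S) (s0' : Me.S)
    (b : ℕ) (hb : 1 ≤ b) :
    2 ^ n * errCount tk Mo Me s0 s0' b ≤ errCount tk Mo Me s0 s0' (b + 1) := by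
  have hcard : 2 ^ n = Fintype.card (Inp n) := by simp
  unfold errCount
  rw [hcard, ← Fintype.card_prod]
  refine Fintype.card_le_of_injective
    (fun q => ⟨(Fin.snoc (α := fun _ => Inp n) q.2.1.1 q.1, q.2.1.2), fun h => q.2.2 ?_⟩) ?_
  · funext t
    have ht := congrFun h t.castSucc
    simpa only [fOut, fOut', Mealy.out_snoc_castSucc] using ht
  · rintro ⟨x, ⟨i, k⟩, _⟩ ⟨y, ⟨j, l⟩, _⟩ h
    obtain ⟨hs, rfl⟩ := Prod.mk.inj (Subtype.mk.inj h)
    obtain ⟨rfl, rfl⟩ := Fin.snoc_injective2 (α := fun _ => Inp n) hs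
    rfl
end

section
/- Fix b ≥ 1 and a key k : Fin t_k → Inp. If there exists an input i : Fin (b+1) → Inp such that f_{b+1}(i) ≠ f'_{b+1}(i, k) and every such erring input at depth b+1 has an agreeing prefix (for all i with f_{b+1}(i) ≠ f'_{b+1}(i, k), f_b(pre(i)) = f'_b(pre(i), k)), then k is not distinguishable at depth b: for every j : Fin b → Inp, f_b(j) = f'_b(j, k). -/
/-- if `k` errs at depth `b+1` but every erring input at depth `b+1` has an
agreeing prefix, then `k` is not distinguishable at depth `b`. -/
theorem stmt_16 (n m tk : ℕ) (hn : 1 ≤ n) (hm : 1 ≤ m) (htk : 1 ≤ tk)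
    (Mo Me : Mealy (Inp n) (Out m)) (s0 : Mo.S) (s0' : Me.S)
    (b : ℕ) (hb : 1 ≤ b) (k : Fin tk → Inp n)
    (hex : ∃ i : Fin (b + 1) → Inp n,
      fOut Mo s0 (b + 1) i ≠ fOut' tk Me s0' (b + 1) i k)
    (hall : ∀ i : Fin (b + 1) → Inp n,
      fOut Mo s0 (b + 1) i ≠ fOut' tk Me s0' (b + 1) i k →
      fOut Mo s0 b (pre i) = fOut' tk Me s0' b (pre i) k) :
    ∀ j : Fin b → Inp n, fOut Mo s0 b j = fOut' tk Me s0' b j k := by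
  intro j
  by_contra hj
  have hpre : pre (Fin.snoc j default : Fin (b + 1) → Inp n) = j := Fin.init_snoc ..
  refine hj (hpre ▸ hall (Fin.snoc j default) fun h => hj ?_)
  rw [← hpre]
  exact congrArg pre h
end
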